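/- arXiv:2604.00129 — 3 statements merged into one kernel-verified Lean document; each statement's English description precedes it below -/
import Mathlib

section
/- Suppose (i,j) ∈ M*(b,s) for some bid profile (b,s). Then for any bid b'_i > b_i of buyer i, the pair (i,j) is also contained in the maximum-weight matching for the profile ((b'_i, b_{-i}), s); that is, (i,j) ∈ M*((b'_i, b_{-i}), s). -/
open Finset

noncomputable section

/-- The weight of a set of buyer–seller edges `M` under buyer bids `b` and seller bids `s`:
`∑_{(i,j)∈M} (b i − s j)`. -/
def matchWeight {m n : ℕ} (b : Fin m → ℝ) (s : Fin n → ℝ)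
    (M : Finset (Fin m × Fin n)) : ℝ :=
  ∑ e ∈ M, (b e.1 - s e.2)

/-- A set of edges is a matching: no two distinct edges share a buyer or share a seller. -/
def IsMatching {m n : ℕ} (M : Finset (Fin m × Fin n)) : Prop :=
  ∀ e ∈ M, ∀ e' ∈ M, e ≠ e' → e.1 ≠ e'.1 ∧ e.2 ≠ e'.2

/-- A two-sided matching market with `m` buyers and `n` sellers: a finite edge set `E`,
a nonempty downward-closed family `Fam` of matchings contained in `E`, a fixed strict
linear tie-breaking order `tb` on `Fam`, and the selection `Mstar b s` of the `tb`-least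
maximum-weight member of `Fam`. -/
structure MarketSetup (m n : ℕ) where
  E : Finset (Fin m × Fin n)
  Fam : Finset (Finset (Fin m × Fin n))
  tb : Finset (Fin m × Fin n) → Finset (Fin m × Fin n) → Prop
  Mstar : (Fin m → ℝ) → (Fin n → ℝ) → Finset (Fin m × Fin n)
  empty_mem : ∅ ∈ Fam
  subset_E : ∀ M ∈ Fam, M ⊆ E
  matching : ∀ M ∈ Fam, IsMatching M
  downward_closed : ∀ M ∈ Fam, ∀ M' ⊆ M, M' ∈ Fam
  tb_irrefl : ∀ M ∈ Fam, ¬ tb M M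
  tb_trans : ∀ M₁ ∈ Fam, ∀ M₂ ∈ Fam, ∀ M₃ ∈ Fam, tb M₁ M₂ → tb M₂ M₃ → tb M₁ M₃
  tb_total : ∀ M₁ ∈ Fam, ∀ M₂ ∈ Fam, M₁ ≠ M₂ → tb M₁ M₂ ∨ tb M₂ M₁
  Mstar_mem : ∀ b s, Mstar b s ∈ Fam
  Mstar_max : ∀ b s, ∀ M ∈ Fam, matchWeight b s M ≤ matchWeight b s (Mstar b s)
  Mstar_lt : ∀ b s, ∀ M ∈ Fam,
      matchWeight b s M = matchWeight b s (Mstar b s) → M ≠ Mstar b s →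
      tb (Mstar b s) M

/-- Raising the bid of buyer `i` to `b'` adds `b' - b i` to the weight for each edge at `i`. -/
lemma matchWeight_update {m n : ℕ} (b : Fin m → ℝ) (s : Fin n → ℝ) (i : Fin m) (b' : ℝ)
    (M : Finset (Fin m × Fin n)) :
    matchWeight (Function.update b i b') s M =
      matchWeight b s M + (M.filter (fun e => e.1 = i)).card * (b' - b i) := by
  unfold matchWeight
  rw [← nsmul_eq_mul, ← Finset.sum_const, Finset.sum_filter, ← Finset.sum_add_distrib]
  refine Finset.sum_congr rfl fun e _ => ?_
  by_cases h : e.1 = i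
  · simp only [h, Function.update_self, if_true]
    ring
  · simp [h]

/-- A matching has at most one edge at each buyer. -/
lemma IsMatching.card_filter_fst_le_one {m n : ℕ} {M : Finset (Fin m × Fin n)}
    (hM : IsMatching M) (i : Fin m) : (M.filter (fun e => e.1 = i)).card ≤ 1 := by
  refine Finset.card_le_one.2 fun e he f hf => ?_
  rw [Finset.mem_filter] at he hf
  by_contra hne
  exact (hM e he.1 f hf.1 hne).1 (he.2.trans hf.2.symm)

/-- Tie-breaking is independent of the bids: if each of two selected matchings also
has maximum weight for the bids selecting the other, they coincide. -/
lemma MarketSetup.Mstar_eq_of_matchWeight_eq {m n : ℕ} (mk : MarketSetup m n)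
    {b c : Fin m → ℝ} {s t : Fin n → ℝ}
    (h₁ : matchWeight b s (mk.Mstar c t) = matchWeight b s (mk.Mstar b s))
    (h₂ : matchWeight c t (mk.Mstar b s) = matchWeight c t (mk.Mstar c t)) :
    mk.Mstar b s = mk.Mstar c t := by
  by_contra hne
  have hb := mk.Mstar_mem b s
  have hc := mk.Mstar_mem c t
  exact mk.tb_irrefl _ hb (mk.tb_trans _ hb _ hc _ hb
    (mk.Mstar_lt b s _ hc h₁ (Ne.symm hne)) (mk.Mstar_lt c t _ hb h₂ hne))

/-- If `(i,j) ∈ M*(b,s)`, then for any bid `b'ᵢ > bᵢ` of buyer `i`,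
`(i,j) ∈ M*((b'ᵢ, b₋ᵢ), s)`. -/
theorem mwm_monotone_buyer {m n : ℕ} (mk : MarketSetup m n)
    (b : Fin m → ℝ) (s : Fin n → ℝ) (i : Fin m) (j : Fin n)
    (hij : (i, j) ∈ mk.Mstar b s)
    (b' : ℝ) (hb' : b i < b') :
    (i, j) ∈ mk.Mstar (Function.update b i b') s := by
  have hle := mk.Mstar_max b s _ (mk.Mstar_mem (Function.update b i b') s)
  have hge := mk.Mstar_max (Function.update b i b') s _ (mk.Mstar_mem b s)
  have hcard : 1 ≤ ((mk.Mstar b s).filter (fun e => e.1 = i)).card :=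
    Finset.card_pos.2 ⟨(i, j), Finset.mem_filter.2 ⟨hij, rfl⟩⟩
  have hcard' := (mk.matching _ (mk.Mstar_mem (Function.update b i b') s)).card_filter_fst_le_one i
  have hmul : (((mk.Mstar (Function.update b i b') s).filter (fun e => e.1 = i)).card : ℝ)
      * (b' - b i) ≤ ((mk.Mstar b s).filter (fun e => e.1 = i)).card * (b' - b i) :=
    mul_le_mul_of_nonneg_right (by exact_mod_cast hcard'.trans hcard) (sub_nonneg.2 hb'.le)
  have hu := matchWeight_update b s i b' (mk.Mstar b s)
  have hu' := matchWeight_update b s i b' (mk.Mstar (Function.update b i b') s)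
  rwa [← mk.Mstar_eq_of_matchWeight_eq (b := b) (s := s) (by linarith) (by linarith)]
end
end

section
/- Suppose that for each edge (i,j) ∈ E the rule X^S_{ij} is cap-monotone and buyer-monotone. Then the seller-run Meta-Auction allocation MA(S) is monotone for the buyers: for any seller cost vector c, any buyer i, any reports b_{-i} of the other buyers, and any two bids b'_i > b_i, if buyer i trades (with some seller j) in MA(S) at the profile ((b_i, b_{-i}), c), then buyer i also trades (with the same seller j) in MA(S) at the profile ((b'_i, b_{-i}), c). -/
open Finset

noncomputable section

/-- The set of costs `c` of seller `j` for which `(i,j)` lies in the maximum-weight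
matching `M*(b, (c, s₋ⱼ))`. -/
def critSet {m n : ℕ} (mk : MarketSetup m n) (i : Fin m) (j : Fin n)
    (b : Fin m → ℝ) (s : Fin n → ℝ) : Set ℝ :=
  {c : ℝ | (i, j) ∈ mk.Mstar b (Function.update s j c)}

/-- The critical cost `c̄_ij(b, s₋ⱼ) = sup {c ∈ ℝ : (i,j) ∈ M*(b, (c, s₋ⱼ))}`,
taken in the extended reals, with `sup ∅ = −∞`. -/
def critCost {m n : ℕ} (mk : MarketSetup m n) (i : Fin m) (j : Fin n)
    (b : Fin m → ℝ) (s : Fin n → ℝ) : EReal :=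
  sSup ((fun x : ℝ => (x : EReal)) '' critSet mk i j b s)

/-- A cap-parameterized bilateral-trade allocation rule: `X κ b c = true` iff trade
occurs when the censoring cap is `κ`, the buyer's bid is `b`, and the seller's
reported cost is `c`. -/
def BTRule := EReal → ℝ → ℝ → Bool

/-- Buyer-monotonicity (DSIC-B): if trade occurs at bid `b` it also occurs at any higher bid. -/
def BuyerMonotone (X : BTRule) : Prop :=
  ∀ (κ : EReal) (b b' c : ℝ), b ≤ b' → X κ b c = true → X κ b' c = true

/-- Seller-monotonicity (DSIC-S): if trade occurs at cost `c` it also occurs at any lower cost. -/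
def SellerMonotone (X : BTRule) : Prop :=
  ∀ (κ : EReal) (b c c' : ℝ), c' ≤ c → X κ b c = true → X κ b c' = true

/-- Cap-monotonicity: if trade occurs under cap `κ₁` it also occurs under any larger cap `κ₂`. -/
def CapMonotone (X : BTRule) : Prop :=
  ∀ (κ₁ κ₂ : EReal) (b c : ℝ), κ₁ ≤ κ₂ → X κ₁ b c = true → X κ₂ b c = true

/-- Buyer-run Meta-Auction allocation MA(B): at report profile `(v,s)`, seller `j`
trades with buyer `i` iff `(i,j) ∈ M*(v,s)` and the bilateral rule for the edge
trades under the cap `c̄_ij(v, s₋ⱼ)` with buyer bid `vᵢ` and seller cost `sⱼ`. -/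
def tradesMAB {m n : ℕ} (mk : MarketSetup m n)
    (XB : Fin m × Fin n → BTRule)
    (v : Fin m → ℝ) (s : Fin n → ℝ) (i : Fin m) (j : Fin n) : Prop :=
  (i, j) ∈ mk.Mstar v s ∧
    XB (i, j) (critCost mk i j v s) (v i) (s j) = true

/-- Seller-run Meta-Auction allocation MA(S): at report profile `(b,c)`, buyer `i`
trades with seller `j` iff `(i,j) ∈ M*(b,c)` and the bilateral rule for the edge
trades under the cap `c̄_ij(b, c₋ⱼ)` with buyer bid `bᵢ` and seller cost `cⱼ`. -/
def tradesMAS {m n : ℕ} (mk : MarketSetup m n)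
    (XS : Fin m × Fin n → BTRule)
    (b : Fin m → ℝ) (c : Fin n → ℝ) (i : Fin m) (j : Fin n) : Prop :=
  (i, j) ∈ mk.Mstar b c ∧
    XS (i, j) (critCost mk i j b c) (b i) (c j) = true

/-- Raising the bid of buyer `i` raises the weight of `M` once for every edge of `M` at `i`. -/
theorem matchWeight_update_bid {m n : ℕ} (b : Fin m → ℝ) (s : Fin n → ℝ) (i : Fin m) (x : ℝ)
    (M : Finset (Fin m × Fin n)) :
    matchWeight (Function.update b i x) s M =
      matchWeight b s M + #{e ∈ M | e.1 = i} * (x - b i) := by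
  rw [← nsmul_eq_mul, ← Finset.sum_const, Finset.sum_filter]
  simp only [matchWeight]
  rw [← Finset.sum_add_distrib]
  refine Finset.sum_congr rfl fun e _ => ?_
  by_cases h : e.1 = i
  · simp [h]
  · simp [h]

/-- A matching has at most one edge at each buyer. -/
theorem IsMatching.card_filter_buyer_le_one {m n : ℕ} {M : Finset (Fin m × Fin n)}
    (hM : IsMatching M) (i : Fin m) : #{e ∈ M | e.1 = i} ≤ 1 := by
  refine Finset.card_le_one.2 fun e he e' he' => ?_
  rw [Finset.mem_filter] at he he'
  by_contra hne
  exact (hM e he.1 e' he'.1 hne).1 (he.2.trans he'.2.symm)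

/-- The selected matching is the only maximum-weight member of the family that precedes all
other maximum-weight members. -/
theorem MarketSetup.Mstar_eq_of_tb {m n : ℕ} (mk : MarketSetup m n) (b : Fin m → ℝ)
    (s : Fin n → ℝ) {M : Finset (Fin m × Fin n)} (hM : M ∈ mk.Fam)
    (hmax : matchWeight b s (mk.Mstar b s) ≤ matchWeight b s M)
    (htb : mk.Mstar b s ≠ M → mk.tb M (mk.Mstar b s)) :
    mk.Mstar b s = M := by
  by_contra hne
  have h := mk.Mstar_lt b s M hM (le_antisymm (mk.Mstar_max b s M hM) hmax) (Ne.symm hne)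
  exact mk.tb_irrefl M hM (mk.tb_trans M hM _ (mk.Mstar_mem b s) M hM (htb hne) h)

/-- A matched buyer who raises her bid does not change the selected matching. -/
theorem MarketSetup.Mstar_update_bid {m n : ℕ} (mk : MarketSetup m n) (b : Fin m → ℝ)
    (s : Fin n → ℝ) {i : Fin m} {j : Fin n} {x : ℝ} (hx : b i ≤ x)
    (hij : (i, j) ∈ mk.Mstar b s) :
    mk.Mstar (Function.update b i x) s = mk.Mstar b s := by
  set M := mk.Mstar b s with hMdef
  set M' := mk.Mstar (Function.update b i x) s with hM'def
  have hM : M ∈ mk.Fam := mk.Mstar_mem b s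
  have hM' : M' ∈ mk.Fam := mk.Mstar_mem _ s
  have hcard : #{e ∈ M' | e.1 = i} ≤ #{e ∈ M | e.1 = i} :=
    ((mk.matching M' hM').card_filter_buyer_le_one i).trans
      (Finset.card_pos.2 ⟨(i, j), by simp [hij]⟩)
  have hgain : (#{e ∈ M' | e.1 = i} : ℝ) * (x - b i) ≤ #{e ∈ M | e.1 = i} * (x - b i) :=
    mul_le_mul_of_nonneg_right (by exact_mod_cast hcard) (sub_nonneg.2 hx)
  have hold : matchWeight b s M' ≤ matchWeight b s M := mk.Mstar_max b s M' hM'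
  have hnew : matchWeight (Function.update b i x) s M ≤
      matchWeight (Function.update b i x) s M' := mk.Mstar_max _ s M hM
  refine mk.Mstar_eq_of_tb _ s hM ?_ fun hne => mk.Mstar_lt b s M' hM' ?_ hne
  · rw [matchWeight_update_bid, matchWeight_update_bid]
    linarith
  · rw [matchWeight_update_bid, matchWeight_update_bid] at hnew
    linarith

/-- The critical cost of an edge is monotone in the bid of its buyer. -/
theorem critCost_le_update_bid {m n : ℕ} (mk : MarketSetup m n) (i : Fin m) (j : Fin n)
    (b : Fin m → ℝ) (s : Fin n → ℝ) {x : ℝ} (hx : b i ≤ x) :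
    critCost mk i j b s ≤ critCost mk i j (Function.update b i x) s := by
  refine sSup_le_sSup (Set.image_mono fun c hc => ?_)
  rw [critSet, Set.mem_ofPred_eq] at hc ⊢
  rwa [mk.Mstar_update_bid b _ hx hc]

/-- If every edge rule `X^S_{ij}` is cap-monotone and buyer-monotone,
then the seller-run Meta-Auction allocation is monotone for the buyers: if buyer `i`
trades with seller `j` at `((bᵢ, b₋ᵢ), c)` and `b'ᵢ > bᵢ`, then buyer `i` trades with
the same seller `j` at `((b'ᵢ, b₋ᵢ), c)`. -/
theorem MAS_monotone_for_buyers {m n : ℕ} (mk : MarketSetup m n)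
    (XS : Fin m × Fin n → BTRule)
    (hXcap : ∀ e ∈ mk.E, CapMonotone (XS e))
    (hXbuy : ∀ e ∈ mk.E, BuyerMonotone (XS e))
    (b : Fin m → ℝ) (c : Fin n → ℝ) (i : Fin m) (j : Fin n)
    (bi' : ℝ) (hb : b i < bi')
    (htrade : tradesMAS mk XS b c i j) :
    tradesMAS mk XS (Function.update b i bi') c i j := by
  obtain ⟨hmem, hX⟩ := htrade
  have hE : (i, j) ∈ mk.E := mk.subset_E _ (mk.Mstar_mem b c) hmem
  refine ⟨by rwa [mk.Mstar_update_bid b c hb.le hmem], ?_⟩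
  rw [Function.update_self]
  exact hXbuy _ hE _ _ _ _ hb.le
    (hXcap _ hE _ _ _ _ (critCost_le_update_bid mk i j b c hb.le) hX)
end
end

section
/- Let F : ℝ → [0,1] be a nondecreasing function (a CDF), let λ ∈ (0,1), and for a cap κ ∈ ℝ define the censored CDF F_κ(x) := F(min(x, κ)). The MultiQuantile rule posts the price p(κ, c) := F_κ^{-1}(min{1, F_κ(c)/λ}) (an element of ℝ ∪ {−∞,+∞}) and trades if and only if the buyer's bid b satisfies b ≥ p(κ, c) as extended reals. Then for any two caps κ1 ≤ κ2 and any seller cost c with c ≤ κ1, one has p(κ2, c) ≤ p(κ1, c); in particular, for every buyer bid b, if b ≥ p(κ1, c) then b ≥ p(κ2, c), i.e., MultiQuantile is cap-monotone in the regime where the seller's cost does not exceed the smaller cap. -/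
noncomputable section

/-- Generalized inverse of a nondecreasing function `G : ℝ → [0,1]`:
`G⁻¹(q) = inf {x ∈ ℝ : G x ≥ q}`, taken in the extended reals
(so `inf ∅ = +∞` and `inf ℝ = −∞`). -/
def genInv (G : ℝ → ℝ) (q : ℝ) : EReal :=
  sInf ((fun x : ℝ => (x : EReal)) '' {x : ℝ | q ≤ G x})

/-- A pointwise larger function has a smaller generalized inverse. -/
theorem genInv_anti {G H : ℝ → ℝ} (hGH : ∀ x, G x ≤ H x) (q : ℝ) :
    genInv H q ≤ genInv G q :=
  sInf_le_sInf (Set.image_mono fun x hx => le_trans hx (hGH x))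

/-- Let `F : ℝ → [0,1]` be a nondecreasing CDF, `λ ∈ (0,1)`, and for a
cap `κ ∈ ℝ` let `F_κ(x) = F(min(x,κ))` be the censored CDF.  The MultiQuantile rule
posts the price `p(κ,c) = F_κ⁻¹(min{1, F_κ(c)/λ})` and trades iff the buyer's bid `b`
satisfies `b ≥ p(κ,c)` in the extended reals.  Then for caps `κ₁ ≤ κ₂` and any seller
cost `c ≤ κ₁` we have `p(κ₂,c) ≤ p(κ₁,c)`; in particular every buyer bid `b` with
`b ≥ p(κ₁,c)` also satisfies `b ≥ p(κ₂,c)`, i.e. MultiQuantile is cap-monotone in the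
regime where the seller's cost does not exceed the smaller cap. -/
theorem multiQuantile_cap_monotone
    (F : ℝ → ℝ) (hFmono : Monotone F)
    (hF0 : ∀ x, 0 ≤ F x) (hF1 : ∀ x, F x ≤ 1)
    (lam : ℝ) (hlam : lam ∈ Set.Ioo (0 : ℝ) 1)
    (price : ℝ → ℝ → EReal)
    (hprice : ∀ κ c, price κ c =
      genInv (fun x => F (min x κ)) (min 1 (F (min c κ) / lam)))
    (κ₁ κ₂ : ℝ) (hκ : κ₁ ≤ κ₂) (c : ℝ) (hc : c ≤ κ₁) :
    price κ₂ c ≤ price κ₁ c ∧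
      ∀ b : ℝ, price κ₁ c ≤ (b : EReal) → price κ₂ c ≤ (b : EReal) := by
  have h : price κ₂ c ≤ price κ₁ c := by
    rw [hprice, hprice, min_eq_left hc, min_eq_left (hc.trans hκ)]
    exact genInv_anti (fun x => hFmono (min_le_min_left x hκ)) _
  exact ⟨h, fun b hb => h.trans hb⟩
end
end
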